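/- Let k ≥ 2 be an integer and c ≥ 11/3 a real number. If G is a finite simple graph of order n with minimum degree δ(G) ≥ √(c·γ·(k−1)·n), then G has a k-proper partition 𝒫 with |𝒫| ≤ ⌊c·γ·n/δ(G)⌋. -/

import Mathlib

open SimpleGraph

/-- A graph is `k`-connected if the removal of any set of fewer than `k` vertices
results in a connected graph with at least two vertices. -/
def KConnected {V : Type*} (k : ℕ) (G : SimpleGraph V) : Prop :=
  ∀ S : Set V, S.ncard < k → (G.induce Sᶜ).Connected ∧ 2 ≤ Sᶜ.ncard

/-- A partition of the vertex set of `G` is `k`-proper if every part induces a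
`k`-connected subgraph. -/
def KProperPartition {V : Type*} [Fintype V] [DecidableEq V] (k : ℕ) (G : SimpleGraph V)
    (P : Finpartition (Finset.univ : Finset V)) : Prop :=
  ∀ p ∈ P.parts, KConnected k (G.induce (p : Set V))

/-- `G` contains a `k`-connected subgraph. -/
def HasKConnSubgraph {V : Type*} (k : ℕ) (G : SimpleGraph V) : Prop :=
  ∃ H : G.Subgraph, KConnected k H.coe

/-- `e(k,n)`: the maximum number of edges of a simple graph of order `n`
containing no `k`-connected subgraph. -/
noncomputable def maxEdgesNoKConn (k n : ℕ) : ℕ :=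
  sSup {m : ℕ | ∃ G : SimpleGraph (Fin n), ¬ HasKConnSubgraph k G ∧ G.edgeSet.ncard = m}

/-- `d(k) = sup { (2 e(k,n) + 2)/n : n > k }`. -/
noncomputable def dConst (k : ℕ) : ℝ :=
  sSup {x : ℝ | ∃ n : ℕ, k < n ∧ x = (2 * (maxEdgesNoKConn k n : ℝ) + 2) / (n : ℝ)}

/-- `γ = sup { d(k)/(k-1) : k ≥ 2 }`. -/
noncomputable def gammaConst : ℝ :=
  sSup {x : ℝ | ∃ k : ℕ, 2 ≤ k ∧ x = dConst k / ((k : ℝ) - 1)}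

open Finset in
/-- A finite vertex set `W` induces a `k`-connected subgraph of `G`, expressed by means of
separations: `W` has more than `k` vertices, and any two disjoint nonempty subsets of `W` with no
edge between them miss at least `k` vertices of `W`. -/
def IsKConnectedOn {V : Type*} (G : SimpleGraph V) (k : ℕ) (W : Finset V) : Prop :=
  k < #W ∧ ∀ A ⊆ W, ∀ B ⊆ W, A.Nonempty → B.Nonempty → Disjoint A B →
    (∀ a ∈ A, ∀ b ∈ B, ¬ G.Adj a b) → #A + #B + k ≤ #W

namespace IsKConnectedOn

open Finset

variable {V X : Type*} {G : SimpleGraph V} {H : SimpleGraph X} {k l : ℕ}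

theorem mono {W : Finset V} (h : IsKConnectedOn G k W) (hl : l ≤ k) : IsKConnectedOn G l W :=
  ⟨hl.trans_lt h.1, fun A hA B hB hA0 hB0 hd hn ↦ by
    have := h.2 A hA B hB hA0 hB0 hd hn
    omega⟩

theorem insert [DecidableEq V] [DecidableRel G.Adj] {W : Finset V} {v : V}
    (h : IsKConnectedOn G k W) (hv : v ∉ W) (hd : k ≤ #{u ∈ W | G.Adj v u}) :
    IsKConnectedOn G k (insert v W) := by
  have key : ∀ A B : Finset V, A ⊆ Insert.insert v W → B ⊆ Insert.insert v W → A.Nonempty →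
      B.Nonempty → Disjoint A B → (∀ a ∈ A, ∀ b ∈ B, ¬ G.Adj a b) → v ∈ A →
      #A + #B + k ≤ #W + 1 := by
    intro A B hA hB hA0 hB0 hAB hn hvA
    have hvB : v ∉ B := Finset.disjoint_left.1 hAB hvA
    have hBW : B ⊆ W := (Finset.subset_insert_iff_of_notMem hvB).1 hB
    have hcard := Finset.card_erase_add_one hvA
    rcases (A.erase v).eq_empty_or_nonempty with h0 | h0
    · have hdis : Disjoint B {u ∈ W | G.Adj v u} := by
        rw [Finset.disjoint_left]
        intro b hb hb'
        exact hn v hvA b hb (Finset.mem_filter.1 hb').2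
      have hle := Finset.card_le_card
        (Finset.union_subset hBW (Finset.filter_subset (fun u ↦ G.Adj v u) W))
      rw [Finset.card_union_of_disjoint hdis] at hle
      rw [h0, Finset.card_empty] at hcard
      omega
    · have := h.2 (A.erase v) (Finset.subset_insert_iff.1 hA) B hBW h0 hB0
        (hAB.mono_left (Finset.erase_subset _ _))
        (fun a ha ↦ hn a (Finset.mem_of_mem_erase ha))
      omega
  have hc := Finset.card_insert_of_notMem hv
  refine ⟨by have := h.1; omega, fun A hA B hB hA0 hB0 hAB hn ↦ ?_⟩
  rw [hc]
  by_cases hvA : v ∈ A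
  · exact key A B hA hB hA0 hB0 hAB hn hvA
  by_cases hvB : v ∈ B
  · have := key B A hB hA hB0 hA0 hAB.symm (fun b hb a ha hab ↦ hn a ha b hb hab.symm) hvB
    omega
  have := h.2 A ((Finset.subset_insert_iff_of_notMem hvA).1 hA) B
    ((Finset.subset_insert_iff_of_notMem hvB).1 hB) hA0 hB0 hAB hn
  omega

theorem map {W : Finset X} (h : IsKConnectedOn H k W) (f : X ↪ V)
    (hf : ∀ x y, H.Adj x y → G.Adj (f x) (f y)) : IsKConnectedOn G k (W.map f) := by
  refine ⟨by simpa using h.1, fun A hA B hB hA0 hB0 hAB hn ↦ ?_⟩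
  obtain ⟨A, hA', rfl⟩ := Finset.subset_map_iff.1 hA
  obtain ⟨B, hB', rfl⟩ := Finset.subset_map_iff.1 hB
  simp only [Finset.card_map]
  refine h.2 A hA' B hB' (by simpa using hA0) (by simpa using hB0)
    ((Finset.disjoint_map f).1 hAB) fun a ha b hb hab ↦ ?_
  exact hn (f a) (Finset.mem_map_of_mem f ha) (f b) (Finset.mem_map_of_mem f hb) (hf _ _ hab)

theorem of_map {W : Finset X} (f : X ↪ V) (h : IsKConnectedOn G k (W.map f))
    (hf : ∀ x y, G.Adj (f x) (f y) → H.Adj x y) : IsKConnectedOn H k W := by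
  refine ⟨by simpa using h.1, fun A hA B hB hA0 hB0 hAB hn ↦ ?_⟩
  have := h.2 (A.map f) (Finset.map_subset_map.2 hA) (B.map f) (Finset.map_subset_map.2 hB)
    (by simpa using hA0) (by simpa using hB0) ((Finset.disjoint_map f).2 hAB) ?_
  · simpa using this
  · intro a ha b hb hab
    obtain ⟨x, hx, rfl⟩ := Finset.mem_map.1 ha
    obtain ⟨y, hy, rfl⟩ := Finset.mem_map.1 hb
    exact hn x hx y hy (hf _ _ hab)

end IsKConnectedOn

open Finset in
theorem isKConnectedOn_univ_iff {X : Type*} [Fintype X] {H : SimpleGraph X} {k : ℕ}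
    (hk : 1 ≤ k) : IsKConnectedOn H k univ ↔ KConnected k H := by
  classical
  constructor
  · rintro ⟨hcard, hsep⟩ S hS
    rw [Finset.card_univ, ← Nat.card_eq_fintype_card] at hcard
    have hadd := Set.ncard_add_ncard_compl S
    have h2 : 2 ≤ Sᶜ.ncard := by omega
    refine ⟨?_, h2⟩
    have hne : Sᶜ.Nonempty := Set.nonempty_of_ncard_ne_zero (by omega)
    have : Nonempty ↥Sᶜ := hne.to_subtype
    refine ⟨fun x y ↦ ?_⟩
    by_contra hxy
    let A : Finset X := {u | ∃ hu : u ∈ Sᶜ, (H.induce Sᶜ).Reachable x ⟨u, hu⟩}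
    let B : Finset X := {u | ∃ hu : u ∈ Sᶜ, ¬ (H.induce Sᶜ).Reachable x ⟨u, hu⟩}
    have hdis : Disjoint A B := by
      rw [Finset.disjoint_left]
      intro a ha hb
      simp only [A, B, Finset.mem_filter, Finset.mem_univ, true_and] at ha hb
      exact hb.2 ha.2
    have hle := hsep A (subset_univ _) B (subset_univ _)
      ⟨x, by simp only [A, Finset.mem_filter, Finset.mem_univ, true_and]; exact ⟨x.2, .refl _⟩⟩
      ⟨y, by simp only [B, Finset.mem_filter, Finset.mem_univ, true_and]; exact ⟨y.2, hxy⟩⟩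
      hdis ?_
    · have hU : Sᶜ = ((A ∪ B : Finset X) : Set X) := by
        ext u
        simp only [A, B, Finset.coe_union, Finset.coe_filter, Finset.mem_univ, true_and,
          Set.mem_union, Set.mem_ofPred_eq]
        constructor
        · intro hu
          by_cases h : (H.induce Sᶜ).Reachable x ⟨u, hu⟩
          · exact .inl ⟨hu, h⟩
          · exact .inr ⟨hu, h⟩
        · rintro (⟨h, -⟩ | ⟨h, -⟩) <;> exact h
      rw [hU, Set.ncard_coe_finset, Finset.card_union_of_disjoint hdis] at hadd
      rw [Finset.card_univ, ← Nat.card_eq_fintype_card] at hle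
      omega
    · intro a ha b hb hab
      simp only [A, B, Finset.mem_filter, Finset.mem_univ, true_and] at ha hb
      obtain ⟨ha, hra⟩ := ha
      obtain ⟨hb, hrb⟩ := hb
      exact hrb (hra.trans (SimpleGraph.Adj.reachable (G := H.induce Sᶜ)
        (u := ⟨a, ha⟩) (v := ⟨b, hb⟩) hab))
  · intro h
    constructor
    · obtain ⟨S, -, hS⟩ := Finset.exists_subset_card_eq
        (s := (univ : Finset X)) (n := min (k - 1) (Fintype.card X)) (by simp)
      have h1 := (h (S : Set X) (by rw [Set.ncard_coe_finset]; omega)).2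
      have hadd := Set.ncard_add_ncard_compl (S : Set X)
      rw [Set.ncard_coe_finset, Nat.card_eq_fintype_card] at hadd
      rw [Finset.card_univ]
      omega
    · rintro A - B - ⟨a, ha⟩ ⟨b, hb⟩ hAB hn
      by_contra! hlt
      have hc := Finset.card_union_of_disjoint hAB
      have hadd := Finset.card_compl_add_card (A ∪ B)
      rw [Finset.card_univ] at hlt
      obtain ⟨hconn, -⟩ := h (((A ∪ B)ᶜ : Finset X) : Set X)
        (by rw [Set.ncard_coe_finset]; omega)
      have hmem : ∀ u, u ∈ ((((A ∪ B)ᶜ : Finset X) : Set X))ᶜ ↔ u ∈ A ∨ u ∈ B := fun u ↦ by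
        rw [← Finset.coe_compl, compl_compl, Finset.mem_coe, Finset.mem_union]
      obtain ⟨p⟩ := hconn.preconnected ⟨a, (hmem a).2 (.inl ha)⟩ ⟨b, (hmem b).2 (.inr hb)⟩
      obtain ⟨d, -, hd1, hd2⟩ := p.exists_boundary_dart {u | u.1 ∈ A} ha
        (Finset.disjoint_right.1 hAB hb)
      exact hn _ hd1 _ (((hmem _).1 d.snd.2).resolve_left hd2) d.adj

theorem IsKConnectedOn.kConnected_induce {V : Type*} {G : SimpleGraph V} {k : ℕ} (hk : 1 ≤ k)
    {W : Finset V} (h : IsKConnectedOn G k W) : KConnected k (G.induce (W : Set V)) := by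
  rw [← isKConnectedOn_univ_iff hk]
  refine IsKConnectedOn.of_map (G := G) (Function.Embedding.subtype _) ?_ fun x y hxy ↦ hxy
  convert h
  ext u
  simp

theorem hasKConnSubgraph_iff {V : Type*} [Finite V] {G : SimpleGraph V} {k : ℕ} (hk : 1 ≤ k) :
    HasKConnSubgraph k G ↔ ∃ W : Finset V, IsKConnectedOn G k W := by
  classical
  have := Fintype.ofFinite V
  constructor
  · rintro ⟨H, hH⟩
    rw [← isKConnectedOn_univ_iff hk] at hH
    exact ⟨_, hH.map (Function.Embedding.subtype _) fun x y hxy ↦ H.adj_sub hxy⟩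
  · rintro ⟨W, hW⟩
    refine ⟨(⊤ : G.Subgraph).induce (W : Set V), ?_⟩
    rw [← SimpleGraph.induce_eq_coe_induce_top]
    exact hW.kConnected_induce hk

section Mader

open Finset

variable {V : Type*} (G : SimpleGraph V) [DecidableRel G.Adj]

theorem card_interedges_self_eq_sum (W : Finset V) :
    #(G.interedges W W) = ∑ v ∈ W, #{u ∈ W | G.Adj v u} := by
  rw [SimpleGraph.interedges, Rel.interedges, Finset.card_filter, Finset.sum_product]
  simp only [Finset.card_filter]

/-- A form of Mader's theorem: a graph of large average degree has a `k`-connected subgraph. -/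
theorem exists_isKConnectedOn_of_le_card_interedges [DecidableEq V] {k : ℕ} (hk : 1 ≤ k) (W : Finset V)
    (hW : 2 * k ≤ #W) (hE : 4 * k * #W ≤ #(G.interedges W W) + 4 * k ^ 2) :
    ∃ S ⊆ W, IsKConnectedOn G k S := by
  induction W using Finset.strongInduction with
  | H W ih =>
  have hlt : 2 * k < #W := by
    rcases hW.lt_or_eq with h | h
    · exact h
    have hle : #(G.interedges W W) ≤ #W * (#W - 1) := by
      rw [card_interedges_self_eq_sum]
      refine (Finset.sum_le_card_nsmul W _ (#W - 1) fun v hv ↦ ?_).trans (by simp)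
      rw [← Finset.card_erase_of_mem hv]
      refine Finset.card_le_card fun u hu ↦ ?_
      rw [Finset.mem_filter] at hu
      exact Finset.mem_erase.2 ⟨hu.2.ne', hu.1⟩
    rw [← h] at hE hle
    obtain ⟨j, rfl⟩ : ∃ j, k = j + 1 := ⟨k - 1, by omega⟩
    have : 2 * (j + 1) - 1 = 2 * j + 1 := by omega
    rw [this] at hle
    nlinarith
  by_cases hdeg : ∃ v ∈ W, #{u ∈ W | G.Adj v u} ≤ 2 * k
  · obtain ⟨v, hv, hdv⟩ := hdeg
    have hc := Finset.card_erase_add_one hv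
    have hsub : G.interedges W W ⊆ G.interedges (W.erase v) (W.erase v) ∪
        (({u ∈ W | G.Adj v u} : Finset V).image (fun u ↦ (v, u)) ∪
          ({u ∈ W | G.Adj v u} : Finset V).image (fun u ↦ (u, v))) := by
      rintro ⟨x, y⟩ hxy
      simp only [SimpleGraph.mem_interedges_iff] at hxy
      simp only [Finset.mem_union, SimpleGraph.mem_interedges_iff, Finset.mem_erase,
        Finset.mem_image, Finset.mem_filter, Prod.mk.injEq]
      by_cases hx : x = v
      · subst hx
        exact .inr (.inl ⟨y, ⟨hxy.2.1, hxy.2.2⟩, rfl, rfl⟩)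
      by_cases hy : y = v
      · subst hy
        exact .inr (.inr ⟨x, ⟨hxy.1, hxy.2.2.symm⟩, rfl, rfl⟩)
      exact .inl ⟨⟨hx, hxy.1⟩, ⟨hy, hxy.2.1⟩, hxy.2.2⟩
    have hle := ((Finset.card_le_card hsub).trans (Finset.card_union_le _ _)).trans
      (Nat.add_le_add_left ((Finset.card_union_le _ _).trans
        (Nat.add_le_add Finset.card_image_le Finset.card_image_le)) _)
    obtain ⟨S, hS, hSk⟩ := ih (W.erase v) (Finset.erase_ssubset hv) (by omega) (by nlinarith)
    exact ⟨S, hS.trans (Finset.erase_subset _ _), hSk⟩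
  push Not at hdeg
  by_cases hcon : IsKConnectedOn G k W
  · exact ⟨W, subset_rfl, hcon⟩
  have hsep : ∃ A ⊆ W, ∃ B ⊆ W, A.Nonempty ∧ B.Nonempty ∧ Disjoint A B ∧
      (∀ a ∈ A, ∀ b ∈ B, ¬ G.Adj a b) ∧ #W < #A + #B + k := by
    by_contra! hno
    exact hcon ⟨by omega, fun A hA B hB hA0 hB0 hAB hn ↦ hno A hA B hB hA0 hB0 hAB hn⟩
  obtain ⟨A, hA, B, hB, ⟨a, ha⟩, ⟨b, hb⟩, hAB, hn, hcard⟩ := hsep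
  have hsub : G.interedges W W ⊆
      G.interedges (W \ B) (W \ B) ∪ G.interedges (W \ A) (W \ A) := by
    rintro ⟨x, y⟩ hxy
    simp only [SimpleGraph.mem_interedges_iff] at hxy
    simp only [Finset.mem_union, SimpleGraph.mem_interedges_iff, Finset.mem_sdiff]
    have h1 : x ∈ A → y ∉ B := fun hx hy ↦ hn x hx y hy hxy.2.2
    have h2 : y ∈ A → x ∉ B := fun hy hx ↦ hn y hy x hx hxy.2.2.symm
    have h3 : x ∈ A → x ∉ B := fun h ↦ Finset.disjoint_left.1 hAB h
    have h4 : y ∈ A → y ∉ B := fun h ↦ Finset.disjoint_left.1 hAB h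
    tauto
  have hle := (Finset.card_le_card hsub).trans (Finset.card_union_le _ _)
  have hcA := Finset.card_sdiff_add_card_eq_card hA
  have hcB := Finset.card_sdiff_add_card_eq_card hB
  have hWB : 2 * k ≤ #(W \ B) := by
    refine (hdeg a (hA ha)).le.trans (Finset.card_le_card fun u hu ↦ ?_)
    rw [Finset.mem_filter] at hu
    exact Finset.mem_sdiff.2 ⟨hu.1, fun huB ↦ hn a ha u huB hu.2⟩
  have hWA : 2 * k ≤ #(W \ A) := by
    refine (hdeg b (hB hb)).le.trans (Finset.card_le_card fun u hu ↦ ?_)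
    rw [Finset.mem_filter] at hu
    exact Finset.mem_sdiff.2 ⟨hu.1, fun huA ↦ hn u huA b hb hu.2.symm⟩
  by_cases hEB : 4 * k * #(W \ B) ≤ #(G.interedges (W \ B) (W \ B)) + 4 * k ^ 2
  · obtain ⟨S, hS, hSk⟩ := ih (W \ B) (Finset.sdiff_ssubset hB ⟨b, hb⟩) hWB hEB
    exact ⟨S, hS.trans Finset.sdiff_subset, hSk⟩
  by_cases hEA : 4 * k * #(W \ A) ≤ #(G.interedges (W \ A) (W \ A)) + 4 * k ^ 2
  · obtain ⟨S, hS, hSk⟩ := ih (W \ A) (Finset.sdiff_ssubset hA ⟨a, ha⟩) hWA hEA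
    exact ⟨S, hS.trans Finset.sdiff_subset, hSk⟩
  nlinarith

end Mader

section Constants

open Finset

theorem two_mul_ncard_edgeSet {V : Type*} [Fintype V] (G : SimpleGraph V) [DecidableRel G.Adj] :
    2 * G.edgeSet.ncard = #(G.interedges univ univ) := by
  classical
  rw [card_interedges_self_eq_sum, ← SimpleGraph.coe_edgeFinset, Set.ncard_coe_finset,
    ← G.sum_degrees_eq_twice_card_edges]
  refine Finset.sum_congr rfl fun v _ ↦ ?_
  rw [← G.card_neighborFinset_eq_degree, G.neighborFinset_eq_filter]

theorem two_mul_ncard_edgeSet_le {V : Type*} [Fintype V] (G : SimpleGraph V) :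
    2 * G.edgeSet.ncard ≤ Fintype.card V * Fintype.card V := by
  classical
  rw [two_mul_ncard_edgeSet]
  exact G.card_interedges_le_mul _ _

theorem ncard_edgeSet_le_maxEdgesNoKConn {k n : ℕ} {G : SimpleGraph (Fin n)}
    (hG : ¬ HasKConnSubgraph k G) : G.edgeSet.ncard ≤ maxEdgesNoKConn k n := by
  refine le_csSup ⟨n * n, ?_⟩ ⟨G, hG, rfl⟩
  rintro m ⟨G', -, rfl⟩
  have := two_mul_ncard_edgeSet_le G'
  rw [Fintype.card_fin] at this
  omega

theorem maxEdgesNoKConn_le {k : ℕ} (hk : 1 ≤ k) (n : ℕ) : maxEdgesNoKConn k n ≤ 2 * k * n := by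
  classical
  refine csSup_le' ?_
  rintro m ⟨G, hG, rfl⟩
  rcases lt_or_ge n (2 * k) with hn | hn
  · have := two_mul_ncard_edgeSet_le G
    rw [Fintype.card_fin] at this
    nlinarith
  · by_contra! hlt
    rw [hasKConnSubgraph_iff hk] at hG
    have h2 := two_mul_ncard_edgeSet G
    obtain ⟨S, -, hS⟩ := exists_isKConnectedOn_of_le_card_interedges G hk univ
      (by simpa using hn) (by rw [Finset.card_univ, Fintype.card_fin]; nlinarith)
    exact hG ⟨S, hS⟩

theorem two_mul_maxEdgesNoKConn_add_two_div_le {k n : ℕ} (hk : 2 ≤ k) (hn : k < n) :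
    (2 * (maxEdgesNoKConn k n : ℝ) + 2) / n ≤ 10 * ((k : ℝ) - 1) := by
  have hk' : (2 : ℝ) ≤ k := mod_cast hk
  have hn' : (k : ℝ) + 1 ≤ n := mod_cast hn
  have he : (maxEdgesNoKConn k n : ℝ) ≤ 2 * k * n :=
    mod_cast maxEdgesNoKConn_le (by omega : 1 ≤ k) n
  rw [div_le_iff₀ (by linarith)]
  nlinarith

theorem two_mul_maxEdgesNoKConn_add_two_div_le_dConst {k n : ℕ} (hk : 2 ≤ k) (hn : k < n) :
    (2 * (maxEdgesNoKConn k n : ℝ) + 2) / n ≤ dConst k := by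
  refine le_csSup ⟨10 * ((k : ℝ) - 1), ?_⟩ ⟨n, hn, rfl⟩
  rintro x ⟨m, hm, rfl⟩
  exact two_mul_maxEdgesNoKConn_add_two_div_le hk hm

theorem dConst_le_gammaConst_mul {k : ℕ} (hk : 2 ≤ k) :
    dConst k ≤ gammaConst * ((k : ℝ) - 1) := by
  have hk' : (2 : ℝ) ≤ k := mod_cast hk
  rw [← div_le_iff₀ (by linarith)]
  refine le_csSup ⟨10, ?_⟩ ⟨k, hk, rfl⟩
  rintro x ⟨l, hl, rfl⟩
  have hl' : (2 : ℝ) ≤ l := mod_cast hl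
  rw [div_le_iff₀ (by linarith)]
  refine csSup_le ⟨_, l + 1, by omega, rfl⟩ ?_
  rintro x ⟨m, hm, rfl⟩
  exact two_mul_maxEdgesNoKConn_add_two_div_le hl hm

theorem two_le_gammaConst : 2 ≤ gammaConst := by
  have hE : 2 ≤ maxEdgesNoKConn 2 3 := by
    have hpath : ¬ HasKConnSubgraph 2 (SimpleGraph.pathGraph 3) := by
      rw [hasKConnSubgraph_iff (by norm_num)]
      rintro ⟨S, hS, hsep⟩
      have hS3 : S = univ := by
        rw [← Finset.card_eq_iff_eq_univ, Fintype.card_fin]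
        have := Finset.card_le_univ S
        rw [Fintype.card_fin] at this
        omega
      subst hS3
      have := hsep {0} (by simp) {2} (by simp) (by simp) (by simp) (by simp)
        (by simp [SimpleGraph.pathGraph_adj])
      simp at this
    refine le_trans ?_ (ncard_edgeSet_le_maxEdgesNoKConn hpath)
    rw [← Set.ncard_pair (a := s((0 : Fin 3), 1)) (b := s(1, 2)) (by decide)]
    refine Set.ncard_le_ncard ?_ (Set.toFinite _)
    rintro e (rfl | rfl) <;> simp [SimpleGraph.pathGraph_adj]
  have h1 := two_mul_maxEdgesNoKConn_add_two_div_le_dConst (k := 2) (n := 3) le_rfl (by norm_num)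
  have h2 := dConst_le_gammaConst_mul (k := 2) le_rfl
  have hE' : (2 : ℝ) ≤ maxEdgesNoKConn 2 3 := mod_cast hE
  norm_num at h1 h2
  linarith

/-- An induced subgraph of average degree at least `γ * (k - 1)` has a `k`-connected subgraph. -/
theorem exists_isKConnectedOn_of_gammaConst_le {V : Type*} (G : SimpleGraph V)
    [DecidableRel G.Adj] {k : ℕ} (hk : 2 ≤ k) {W : Finset V} (hW : k < #W)
    (hE : gammaConst * ((k : ℝ) - 1) * #W ≤ #(G.interedges W W)) :
    ∃ S ⊆ W, IsKConnectedOn G k S := by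
  classical
  let f : Fin #W ↪ V := W.equivFin.symm.toEmbedding.trans (Function.Embedding.subtype _)
  have hf : univ.map f = W := by
    ext v
    simp only [Finset.mem_map, Finset.mem_univ, true_and]
    exact ⟨by rintro ⟨i, rfl⟩; exact (W.equivFin.symm i).2,
      fun hv ↦ ⟨W.equivFin ⟨v, hv⟩, by simp [f]⟩⟩
  by_cases hG : HasKConnSubgraph k (G.comap f)
  · obtain ⟨S, hS⟩ := (hasKConnSubgraph_iff (by omega)).1 hG
    refine ⟨S.map f, ?_, hS.map f fun x y hxy ↦ hxy⟩
    conv_rhs => rw [← hf]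
    exact Finset.map_subset_map.2 (Finset.subset_univ S)
  · exfalso
    have hle := ncard_edgeSet_le_maxEdgesNoKConn hG
    have h2 := two_mul_ncard_edgeSet (G.comap f)
    have heq : #((G.comap f).interedges univ univ) = #(G.interedges W W) := by
      rw [← Finset.card_map (f.prodMap f)]
      congr 1
      conv_rhs => rw [← hf]
      ext ⟨x, y⟩
      simp only [Finset.mem_map, SimpleGraph.mem_interedges_iff, Finset.mem_univ, true_and,
        Function.Embedding.coe_prodMap, Prod.exists, Prod.map_apply, Prod.mk.injEq,
        SimpleGraph.comap_adj]
      constructor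
      · rintro ⟨a, b, hab, rfl, rfl⟩
        exact ⟨⟨a, rfl⟩, ⟨b, rfl⟩, hab⟩
      · rintro ⟨⟨a, rfl⟩, ⟨b, rfl⟩, hab⟩
        exact ⟨a, b, hab, rfl, rfl⟩
    have h3 := (two_mul_maxEdgesNoKConn_add_two_div_le_dConst hk hW).trans
      (dConst_le_gammaConst_mul hk)
    have hpos : (0 : ℝ) < #W := by
      exact_mod_cast (by omega : 0 < #W)
    rw [div_le_iff₀ hpos] at h3
    have h4 : (2 * (G.comap f).edgeSet.ncard : ℝ) = #(G.interedges W W) := by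
      exact_mod_cast h2.trans heq
    have h5 : ((G.comap f).edgeSet.ncard : ℝ) ≤ maxEdgesNoKConn k #W := mod_cast hle
    linarith

/-- An induced subgraph of minimum degree `d ≥ γ * (k - 1)` has a `k`-connected subgraph of
order greater than `d / γ`. -/
theorem exists_large_isKConnectedOn {V : Type*} (G : SimpleGraph V) [DecidableRel G.Adj]
    {k : ℕ} (hk : 2 ≤ k) {W : Finset V} (hW : W.Nonempty) {d : ℝ}
    (hd : gammaConst * ((k : ℝ) - 1) ≤ d) (hdeg : ∀ v ∈ W, d ≤ #{u ∈ W | G.Adj v u}) :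
    ∃ S ⊆ W, IsKConnectedOn G k S ∧ d ≤ gammaConst * #S := by
  classical
  have hγ := two_le_gammaConst
  have hk' : (2 : ℝ) ≤ k := mod_cast hk
  have hd2 : 2 ≤ d := by nlinarith
  set m := ⌊d / gammaConst⌋₊ with hm
  have hm1 : (m : ℝ) ≤ d / gammaConst := Nat.floor_le (by positivity)
  have hm2 : d / gammaConst < m + 1 := Nat.lt_floor_add_one _
  rw [le_div_iff₀ (by linarith)] at hm1
  rw [div_lt_iff₀ (by linarith)] at hm2
  have hkm : k ≤ m + 1 := by
    have : k - 1 ≤ m := by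
      rw [hm, Nat.le_floor_iff (by positivity), le_div_iff₀ (by linarith),
        Nat.cast_sub (by omega)]
      push_cast
      linarith
    omega
  have hdW : d + 1 ≤ #W := by
    obtain ⟨v, hv⟩ := hW
    have h1 := hdeg v hv
    have h2 : #{u ∈ W | G.Adj v u} + 1 ≤ #W := by
      rw [← Finset.card_erase_add_one hv]
      gcongr
      intro u hu
      rw [Finset.mem_filter] at hu
      exact Finset.mem_erase.2 ⟨hu.2.ne', hu.1⟩
    have h3 : (#{u ∈ W | G.Adj v u} : ℝ) + 1 ≤ #W := mod_cast h2
    linarith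
  have hmW : m + 1 < #W := by
    have h0 : (0 : ℝ) ≤ m := m.cast_nonneg
    have h1 : (1 : ℝ) ≤ m := by exact_mod_cast (by omega : 1 ≤ m)
    have : (m : ℝ) + 1 < #W := by nlinarith
    exact_mod_cast this
  have hE : gammaConst * (((m + 1 : ℕ) : ℝ) - 1) * #W ≤ #(G.interedges W W) := by
    have h1 : #W • d ≤ ∑ v ∈ W, (#{u ∈ W | G.Adj v u} : ℝ) :=
      Finset.card_nsmul_le_sum _ _ _ hdeg
    rw [card_interedges_self_eq_sum]
    push_cast
    refine le_trans ?_ h1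
    rw [nsmul_eq_mul]
    have : (0 : ℝ) ≤ #W := Nat.cast_nonneg _
    nlinarith
  obtain ⟨S, hS, hSk⟩ := exists_isKConnectedOn_of_gammaConst_le G (by omega) hmW hE
  refine ⟨S, hS, hSk.mono hkm, ?_⟩
  have : (m : ℝ) + 1 ≤ #S := mod_cast hSk.1.le
  nlinarith

end Constants

section Partition

open Finset

variable {V : Type*} [Fintype V] (G : SimpleGraph V)

/-- The colours `1, …, l` of `f` have `k`-connected classes, and `0` marks the vertices that are not
covered. -/
def IsPartialKColoring (k l : ℕ) (f : V → ℕ) : Prop :=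
  (∀ v, f v ≤ l) ∧ ∀ j, 1 ≤ j → j ≤ l → IsKConnectedOn G k {v | f v = j}

variable {G}

theorem IsPartialKColoring.update [DecidableEq V] [DecidableRel G.Adj] {k l : ℕ} {f : V → ℕ}
    (hf : IsPartialKColoring G k l f) {v : V} (hv : f v = 0) {j : ℕ} (hj : 1 ≤ j) (hjl : j ≤ l)
    (hd : k ≤ #{u ∈ {u | f u = j} | G.Adj v u}) :
    IsPartialKColoring G k l (Function.update f v j) := by
  refine ⟨fun u ↦ ?_, fun i hi hil ↦ ?_⟩
  · rw [Function.update_apply]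
    split_ifs
    exacts [hjl, hf.1 u]
  · by_cases hij : i = j
    · subst hij
      convert (hf.2 i hi hil).insert (v := v) (by simp; omega) hd using 1
      ext u
      by_cases huv : u = v <;> simp [huv]
    · convert hf.2 i hi hil using 1
      ext u
      by_cases huv : u = v
      · subst huv
        simp
        omega
      · simp [huv]

theorem IsPartialKColoring.add_class [DecidableEq V] {k l : ℕ} {f : V → ℕ}
    (hf : IsPartialKColoring G k l f) {S : Finset V} (hS : ∀ v ∈ S, f v = 0)
    (hSk : IsKConnectedOn G k S) :
    IsPartialKColoring G k (l + 1) fun v ↦ if v ∈ S then l + 1 else f v := by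
  refine ⟨fun u ↦ ?_, fun i hi hil ↦ ?_⟩
  · dsimp only
    have := hf.1 u
    split_ifs <;> omega
  · by_cases hij : i = l + 1
    · subst hij
      convert hSk using 1
      ext u
      have := hf.1 u
      by_cases huS : u ∈ S
      · simp [huS]
      · simp [huS]
        omega
    · convert hf.2 i hi (by omega) using 1
      ext u
      by_cases huS : u ∈ S
      · have := hS u huS
        simp [huS]
        omega
      · simp [huS]

theorem card_filter_adj_le_of_forall_lt [DecidableRel G.Adj] {k l : ℕ} (hk : 1 ≤ k) {f : V → ℕ}
    (hf : ∀ v, f v ≤ l) (v : V)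
    (hd : ∀ j, 1 ≤ j → j ≤ l → #{u ∈ {u | f u = j} | G.Adj v u} < k) :
    (#{u | G.Adj v u} : ℝ) ≤ #{u ∈ {u | f u = 0} | G.Adj v u} + ((k : ℝ) - 1) * l := by
  have hcard : #{u | G.Adj v u} = ∑ j ∈ range (l + 1), #{u ∈ {u | f u = j} | G.Adj v u} := by
    rw [Finset.card_eq_sum_card_fiberwise (f := f) (t := range (l + 1))
      (fun u _ ↦ by simpa using Nat.lt_succ_of_le (hf u))]
    refine Finset.sum_congr rfl fun j _ ↦ ?_
    rw [Finset.filter_filter, Finset.filter_filter]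
    simp only [and_comm]
  rw [Finset.sum_range_succ'] at hcard
  have hle : ∑ j ∈ range l, #{u ∈ {u | f u = j + 1} | G.Adj v u} ≤ l * (k - 1) := by
    refine (Finset.sum_le_card_nsmul _ _ (k - 1) fun j hj ↦ ?_).trans (by simp)
    have := hd (j + 1) (by omega) (by have := Finset.mem_range.1 hj; omega)
    omega
  have h : #{u | G.Adj v u} ≤ #{u ∈ {u | f u = 0} | G.Adj v u} + l * (k - 1) := by omega
  have h' : (#{u | G.Adj v u} : ℝ) ≤ #{u ∈ {u | f u = 0} | G.Adj v u} + l * ((k - 1 : ℕ) : ℝ) :=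
    mod_cast h
  rw [Nat.cast_sub hk] at h'
  push_cast at h'
  linarith

/-- A partial colouring whose number of colours is controlled by the number of covered vertices
extends to a colouring of all the vertices, with the same control. -/
theorem IsPartialKColoring.exists_total [DecidableRel G.Adj] {k : ℕ} (hk : 2 ≤ k) {d : ℝ}
    (hd0 : 0 < d) (hdeg : ∀ v, d ≤ #{u | G.Adj v u})
    (hd : 11 / 3 * gammaConst * ((k : ℝ) - 1) * Fintype.card V ≤ d ^ 2) {l : ℕ} {f : V → ℕ}
    (hf : IsPartialKColoring G k l f) (hl : ((k : ℝ) - 1) * l ≤ d)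
    (hc : l * d - ((k : ℝ) - 1) * (l * (l - 1) / 2) ≤ gammaConst * #{v | f v ≠ 0}) :
    ∃ (l' : ℕ) (f' : V → ℕ), IsPartialKColoring G k l' f' ∧ (∀ v, f' v ≠ 0) ∧
      l' * d ≤ 2 * gammaConst * Fintype.card V := by
  classical
  induction hN : #{v | f v = 0} using Nat.strong_induction_on generalizing l f with
  | h N ih =>
  have hγ := two_le_gammaConst
  have hk' : (2 : ℝ) ≤ k := mod_cast hk
  have hl0 : (0 : ℝ) ≤ l := l.cast_nonneg
  have hld : l * d ≤ 2 * gammaConst * Fintype.card V := by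
    have h1 : (#{v | f v ≠ 0} : ℝ) ≤ Fintype.card V := mod_cast Finset.card_le_univ _
    have h2 : gammaConst * #{v | f v ≠ 0} ≤ gammaConst * Fintype.card V := by gcongr
    have h3 : ((k : ℝ) - 1) * l * l ≤ d * l := by gcongr
    nlinarith
  by_cases hall : ∀ v, f v ≠ 0
  · exact ⟨l, f, hf, hall, hld⟩
  push Not at hall
  obtain ⟨v₀, hv₀⟩ := hall
  by_cases habs : ∃ v, f v = 0 ∧ ∃ j, 1 ≤ j ∧ j ≤ l ∧ k ≤ #{u ∈ {u | f u = j} | G.Adj v u}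
  · obtain ⟨v, hv, j, hj, hjl, hvj⟩ := habs
    have hlt : #{u | Function.update f v j u = 0} < N := by
      rw [← hN]
      refine Finset.card_lt_card (Finset.ssubset_iff_of_subset ?_ |>.2 ⟨v, ?_, ?_⟩)
      · intro u hu
        simp only [Finset.mem_filter, Finset.mem_univ, true_and] at hu ⊢
        by_cases huv : u = v
        · rwa [huv]
        · rwa [Function.update_of_ne huv] at hu
      · simpa using hv
      · simp
        omega
    refine ih _ hlt (hf.update hv hj hjl hvj) hl (hc.trans ?_) rfl
    refine mul_le_mul_of_nonneg_left (Nat.cast_le.2 (Finset.card_le_card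
      (Finset.monotone_filter_right _ fun u _ hu ↦ ?_))) (by linarith)
    by_cases huv : u = v
    · exact absurd (huv ▸ hv) hu
    · rwa [Function.update_of_ne huv]
  · push Not at habs
    have hn1 : d ≤ Fintype.card V := (hdeg v₀).trans (mod_cast Finset.card_le_univ _)
    have hdγ : 11 / 3 * gammaConst * ((k : ℝ) - 1) ≤ d := by
      have h1 : 0 ≤ 11 / 3 * gammaConst * ((k : ℝ) - 1) := by
        have : (0 : ℝ) ≤ k - 1 := by linarith
        positivity
      have h2 := mul_le_mul_of_nonneg_left hn1 h1
      exact le_of_mul_le_mul_right (by nlinarith) hd0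
    have hl6 : ((k : ℝ) - 1) * l ≤ 6 / 11 * d := by
      have h1 := mul_le_mul_of_nonneg_left hld (by linarith : (0 : ℝ) ≤ k - 1)
      exact le_of_mul_le_mul_right (by nlinarith) hd0
    have hγk : 2 * ((k : ℝ) - 1) ≤ gammaConst * ((k : ℝ) - 1) := by
      have : (0 : ℝ) ≤ k - 1 := by linarith
      gcongr
    obtain ⟨S, hS, hSk, hSd⟩ := exists_large_isKConnectedOn G hk
      (W := ({u | f u = 0} : Finset V)) ⟨v₀, by simpa using hv₀⟩
      (d := d - ((k : ℝ) - 1) * l) (by linarith) (fun v hv ↦ by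
        have h1 := card_filter_adj_le_of_forall_lt (by omega : 1 ≤ k) hf.1 v
          (habs v (by simpa using hv))
        have h2 := hdeg v
        linarith)
    have hS0 : ∀ v ∈ S, f v = 0 := fun v hv ↦ by simpa using hS hv
    have hpos : 0 < #S := by have := hSk.1; omega
    have hsplit : ({v | (if v ∈ S then l + 1 else f v) ≠ 0} : Finset V) =
        ({v | f v ≠ 0} : Finset V) ∪ S := by
      ext u
      by_cases huS : u ∈ S <;> simp [huS]
    have hdisj : Disjoint ({v | f v ≠ 0} : Finset V) S := by
      rw [Finset.disjoint_right]
      intro u hu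
      simpa using hS0 u hu
    have hlt : #{u | (if u ∈ S then l + 1 else f u) = 0} < N := by
      obtain ⟨s, hs⟩ := Finset.card_pos.1 hpos
      rw [← hN]
      refine Finset.card_lt_card (Finset.ssubset_iff_of_subset ?_ |>.2 ⟨s, ?_, ?_⟩)
      · intro u hu
        by_cases huS : u ∈ S
        · simp [huS] at hu
        · simpa [huS] using hu
      · exact hS hs
      · simp [hs]
    refine ih _ hlt (hf.add_class hS0 hSk) ?_ ?_ rfl
    · push_cast
      nlinarith
    · rw [hsplit, Finset.card_union_of_disjoint hdisj]
      push_cast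
      nlinarith

/-- The partition of the vertex set into the classes of a total colouring. -/
theorem IsPartialKColoring.exists_kProperPartition [DecidableEq V] {k l : ℕ} (hk : 1 ≤ k)
    {f : V → ℕ} (hf : IsPartialKColoring G k l f) (h0 : ∀ v, f v ≠ 0) :
    ∃ P : Finpartition (univ : Finset V), KProperPartition k G P ∧ #P.parts ≤ l := by
  let cls : ℕ → Finset V := fun j ↦ {v | f v = j}
  refine ⟨⟨(Icc 1 l).image cls, ?_, ?_, ?_⟩, ?_, ?_⟩
  · rw [Finset.supIndep_iff_pairwiseDisjoint]
    rintro A hA B hB hAB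
    simp only [Finset.coe_image, Set.mem_image] at hA hB
    obtain ⟨i, -, rfl⟩ := hA
    obtain ⟨j, -, rfl⟩ := hB
    refine Finset.disjoint_left.2 fun v hi hj ↦ hAB ?_
    simp only [cls, id, Finset.mem_filter, Finset.mem_univ, true_and] at hi hj
    rw [← hi, ← hj]
  · refine Finset.eq_univ_of_forall fun v ↦ ?_
    rw [Finset.mem_sup]
    refine ⟨cls (f v), Finset.mem_image_of_mem _ (Finset.mem_Icc.2 ⟨?_, hf.1 v⟩), by simp [cls]⟩
    exact Nat.one_le_iff_ne_zero.2 (h0 v)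
  · rw [Finset.mem_image]
    rintro ⟨j, hj, hjb⟩
    have := (hf.2 j (Finset.mem_Icc.1 hj).1 (Finset.mem_Icc.1 hj).2).1
    rw [show ({v | f v = j} : Finset V) = ∅ from hjb] at this
    simp at this
  · intro p hp
    obtain ⟨j, hj, rfl⟩ := Finset.mem_image.1 hp
    exact (hf.2 j (Finset.mem_Icc.1 hj).1 (Finset.mem_Icc.1 hj).2).kConnected_induce hk
  · exact Finset.card_image_le.trans (by simp)

end Partition

/-- **Theorem 5.** Let `k ≥ 2` and `c ≥ 11/3`. If `G` is a graph of order `n` with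
`δ(G) ≥ √(c·γ·(k-1)·n)`, then `G` has a `k`-proper partition with at most
`⌊c·γ·n/δ(G)⌋` parts. -/
theorem k_proper_partition_gamma {V : Type*} [Fintype V] [DecidableEq V]
    (k : ℕ) (hk : 2 ≤ k) (c : ℝ) (hc : c ≥ 11 / 3)
    (G : SimpleGraph V) [DecidableRel G.Adj]
    (hδ : (G.minDegree : ℝ) ≥
      Real.sqrt (c * gammaConst * ((k : ℝ) - 1) * (Fintype.card V : ℝ))) :
    ∃ P : Finpartition (Finset.univ : Finset V), KProperPartition k G P ∧
      (P.parts.card : ℤ) ≤ ⌊c * gammaConst * (Fintype.card V : ℝ) / (G.minDegree : ℝ)⌋ := by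
  have hγ := two_le_gammaConst
  have hk' : (2 : ℝ) ≤ k := mod_cast hk
  rcases isEmpty_or_nonempty V with hV | hV
  · refine ⟨⊥, fun p hp ↦ ?_, by simp⟩
    simp at hp
  · have hn : (0 : ℝ) < Fintype.card V := mod_cast Fintype.card_pos
    have hpos : 0 < gammaConst * ((k : ℝ) - 1) * Fintype.card V :=
      mul_pos (mul_pos (by linarith) (by linarith)) hn
    have hd0 : (0 : ℝ) < G.minDegree :=
      (Real.sqrt_pos.2 (by nlinarith)).trans_le hδ
    have hd2 := (Real.sqrt_le_left hd0.le).1 hδ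
    have hinit : IsPartialKColoring G k 0 fun _ ↦ 0 := ⟨fun _ ↦ le_rfl, fun j h1 h2 ↦ by omega⟩
    obtain ⟨l, f, hf, hf0, hl⟩ := hinit.exists_total hk hd0
      (fun v ↦ by
        have h := G.minDegree_le_degree v
        rw [← G.card_neighborFinset_eq_degree, G.neighborFinset_eq_filter] at h
        exact_mod_cast h)
      (by nlinarith) (by simp) (by simp)
    obtain ⟨P, hP, hPl⟩ := hf.exists_kProperPartition (by omega) hf0
    refine ⟨P, hP, ?_⟩
    rw [Int.le_floor, le_div_iff₀ hd0]
    push_cast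
    have hPl' : (P.parts.card : ℝ) ≤ l := mod_cast hPl
    nlinarith [mul_pos (by linarith : 0 < gammaConst) hn]
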